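/- Fix odd n and let A, B, C, D be four independent random balanced n-sided dice with law μ_n. Define the random variables X := Pr_{B'~μ_n}[A beats B'] (a function of A) and Y := Pr_{A'~μ_n}[A' beats B and A' beats C] (a function of (B,C)). Suppose there are constants ε_1, ε_2, c_1, c_2 > 0 with c_1 − ε_1² − ε_2 ≥ 0 such that Pr[|X − 1/2| ≥ ε_1] ≤ ε_2 and Pr[|Y − 1/4| ≥ c_1] ≥ c_2. Then the probability that the beats relation on (A,B,C,D) is transitive (there is a permutation σ of {1,2,3,4} with the σ(i)-th die beating the σ(j)-th die whenever i < j) is at least 3/8 + 6·c_2·(c_1 − ε_1² − ε_2)². -/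

import Mathlib

open MeasureTheory ProbabilityTheory Set
open scoped ENNReal NNReal

noncomputable def extendDie (n : ℕ) (s : ℝ) (a : Fin (n - 1) → ℝ) : Fin n → ℝ :=
  fun i => if h : (i : ℕ) < n - 1 then a ⟨i, h⟩ else s - ∑ j, a j

noncomputable def diceMeasure (n : ℕ) (lo hi s : ℝ) : Measure (Fin n → ℝ) :=
  Measure.map (extendDie n s)
    (ProbabilityTheory.cond volume
      {a : Fin (n - 1) → ℝ | (∀ i, a i ∈ Set.Icc lo hi) ∧ (s - ∑ i, a i) ∈ Set.Icc lo hi})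

def beats {n : ℕ} (A B : Fin n → ℝ) : Prop :=
  0 < ∑ i : Fin n, ∑ j : Fin n,
      ((if B j < A i then (1 : ℝ) else 0) - (if A i < B j then (1 : ℝ) else 0))

def transitiveOnFour {n : ℕ} (D : Fin 4 → Fin n → ℝ) : Prop :=
  ∃ σ : Equiv.Perm (Fin 4), ∀ i j : Fin 4, i < j → beats (D (σ i)) (D (σ j))

section abs
set_option linter.unusedSectionVars false
variable {α : Type*} [MeasurableSpace α]

def quadMap (σ : Equiv.Perm (Fin 4)) (q : (α × α) × (α × α)) : Fin 4 → α :=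
  fun i => ![q.2.1, q.2.2, q.1.1, q.1.2] (σ.symm i)

theorem quadMap_apply (σ : Equiv.Perm (Fin 4)) (q : (α × α) × (α × α)) (i : Fin 4) :
    quadMap σ q (σ i) = ![q.2.1, q.2.2, q.1.1, q.1.2] i := by
  simp [quadMap]

theorem quadMap_measurable (σ : Equiv.Perm (Fin 4)) : Measurable (quadMap (α := α) σ) := by
  refine measurable_pi_iff.2 fun i => ?_
  unfold quadMap
  generalize σ.symm i = j
  fin_cases j <;> simp <;> fun_prop

theorem quadMap_mp (μ : Measure α) [IsProbabilityMeasure μ] (σ : Equiv.Perm (Fin 4)) :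
    MeasurePreserving (quadMap (α := α) σ) ((μ.prod μ).prod (μ.prod μ))
      (Measure.pi fun _ : Fin 4 => μ) := by
  refine ⟨quadMap_measurable σ, ?_⟩
  symm
  refine Measure.pi_eq fun s hs => ?_
  rw [Measure.map_apply (quadMap_measurable σ) (MeasurableSet.univ_pi hs)]
  have : quadMap σ ⁻¹' (Set.univ.pi s) =
      (s (σ 2) ×ˢ s (σ 3)) ×ˢ (s (σ 0) ×ˢ s (σ 1)) := by
    ext q
    simp only [Set.mem_preimage, Set.mem_univ_pi, Set.mem_prod]
    rw [← σ.forall_congr_right (q := fun i => quadMap σ q i ∈ s i)]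
    simp only [quadMap_apply, Fin.forall_fin_succ]
    simp
    tauto
  rw [this, Measure.prod_prod, Measure.prod_prod, Measure.prod_prod,
    ← Equiv.prod_comp σ, Fin.prod_univ_four]
  ring

variable (μ : Measure α) [IsProbabilityMeasure μ] (R : α → α → Prop)

def quadEvent (σ : Equiv.Perm (Fin 4)) : Set (Fin 4 → α) :=
  {D | (R (D (σ 0)) (D (σ 2)) ∧ R (D (σ 0)) (D (σ 3))) ∧
    (R (D (σ 1)) (D (σ 2)) ∧ R (D (σ 1)) (D (σ 3)))}

theorem rel_meas {R : α → α → Prop} (hR : MeasurableSet {p : α × α | R p.1 p.2})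
    {β : Type*} [MeasurableSpace β]
    {f g : β → α} (hf : Measurable f) (hg : Measurable g) :
    MeasurableSet {b | R (f b) (g b)} := (hf.prodMk hg) hR

theorem quadEvent_meas (hR : MeasurableSet {p : α × α | R p.1 p.2})
    (σ : Equiv.Perm (Fin 4)) : MeasurableSet (quadEvent R σ) := by
  have h : ∀ i j : Fin 4, MeasurableSet {D : Fin 4 → α | R (D i) (D j)} := fun i j =>
    rel_meas hR (measurable_pi_apply i) (measurable_pi_apply j)
  exact ((h _ _).inter (h _ _)).inter ((h _ _).inter (h _ _))

theorem quadEvent_measure (hR : MeasurableSet {p : α × α | R p.1 p.2})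
    (σ : Equiv.Perm (Fin 4)) :
    (Measure.pi fun _ : Fin 4 => μ) (quadEvent R σ) =
      ∫⁻ p, (μ {A | R A p.1 ∧ R A p.2}) ^ 2 ∂(μ.prod μ) := by
  have hm := quadEvent_meas R hR σ
  rw [← (quadMap_mp μ σ).measure_preimage hm.nullMeasurableSet,
    Measure.prod_apply ((quadMap_measurable σ) hm)]
  refine lintegral_congr fun p => ?_
  rw [sq, ← Measure.prod_prod]
  congr 1
  ext q
  simp [quadEvent, quadMap_apply]

theorem EY_meas (hR : MeasurableSet {p : α × α | R p.1 p.2}) :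
    Measurable fun p : α × α => μ {A | R A p.1 ∧ R A p.2} := by
  have : MeasurableSet {q : (α × α) × α | R q.2 q.1.1 ∧ R q.2 q.1.2} :=
    (rel_meas hR (by fun_prop) (by fun_prop)).inter (rel_meas hR (by fun_prop) (by fun_prop))
  exact measurable_measure_prodMk_left this

theorem EX_meas (hR : MeasurableSet {p : α × α | R p.1 p.2}) :
    Measurable fun a : α => μ {B | R a B} := measurable_measure_prodMk_left hR

theorem EX_half (hR : MeasurableSet {p : α × α | R p.1 p.2})
    (hasym : ∀ a b, R a b → ¬ R b a)
    (htot : ∀ᵐ p ∂(μ.prod μ), R p.1 p.2 ∨ R p.2 p.1) :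
    ∫ a, μ.real {B | R a B} ∂μ = 1 / 2 := by
  have h1 : ∫ a, μ.real {B | R a B} ∂μ = (μ.prod μ).real {p | R p.1 p.2} := by
    rw [measureReal_def, Measure.prod_apply hR]
    exact integral_toReal (EX_meas μ R hR).aemeasurable (ae_of_all _ fun _ => measure_lt_top _ _)
  have h2 : (μ.prod μ).real {p | R p.2 p.1} = (μ.prod μ).real {p | R p.1 p.2} := by
    have := (Measure.measurePreserving_swap (μ := μ) (ν := μ)).measure_preimage
      hR.nullMeasurableSet
    rw [measureReal_def, measureReal_def, ← this]
    rfl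
  have h3 : (μ.prod μ).real ({p | R p.1 p.2} ∪ {p | R p.2 p.1}) = 1 := by
    rw [measureReal_def, (prob_compl_eq_zero_iff ?_).1 ?_]
    · simp
    · exact hR.union (rel_meas hR (by fun_prop) (by fun_prop))
    · exact htot
  rw [measureReal_union] at h3
  · rw [h1]; linarith
  · rw [Set.disjoint_left]; exact fun p hp hq => hasym _ _ hp hq
  · exact rel_meas hR (by fun_prop) (by fun_prop)

theorem int_of_bdd {β : Type*} [MeasurableSpace β] (ν : Measure β) [IsProbabilityMeasure ν]
    {f : β → ℝ} (hf : Measurable f) (h0 : ∀ b, 0 ≤ f b) (h1 : ∀ b, f b ≤ 1) :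
    Integrable f ν :=
  Integrable.of_bound hf.aestronglyMeasurable 1
    (ae_of_all _ fun b => by rw [Real.norm_eq_abs, abs_of_nonneg (h0 b)]; exact h1 b)

theorem EY_ge (hR : MeasurableSet {p : α × α | R p.1 p.2})
    (hasym : ∀ a b, R a b → ¬ R b a)
    (htot : ∀ᵐ p ∂(μ.prod μ), R p.1 p.2 ∨ R p.2 p.1) :
    1 / 4 ≤ ∫ p, μ.real {A | R A p.1 ∧ R A p.2} ∂(μ.prod μ) := by
  have hm : MeasurableSet {q : (α × α) × α | R q.2 q.1.1 ∧ R q.2 q.1.2} :=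
    (rel_meas hR (by fun_prop) (by fun_prop)).inter (rel_meas hR (by fun_prop) (by fun_prop))
  have h1 : ∫ p, μ.real {A | R A p.1 ∧ R A p.2} ∂(μ.prod μ) =
      ((μ.prod μ).prod μ).real {q : (α × α) × α | R q.2 q.1.1 ∧ R q.2 q.1.2} := by
    rw [measureReal_def, Measure.prod_apply hm]
    exact integral_toReal (EY_meas μ R hR).aemeasurable (ae_of_all _ fun _ => measure_lt_top _ _)
  have hXm := EX_meas μ R hR
  have h2 : ((μ.prod μ).prod μ).real {q : (α × α) × α | R q.2 q.1.1 ∧ R q.2 q.1.2} =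
      ∫ a, (μ.real {B | R a B}) ^ 2 ∂μ := by
    rw [measureReal_def, Measure.prod_apply_symm hm,
      ← integral_toReal (measurable_measure_prodMk_right hm).aemeasurable
      (ae_of_all _ fun _ => measure_lt_top _ _)]
    refine integral_congr_ae (ae_of_all _ fun a => ?_)
    simp only
    rw [measureReal_def, ← ENNReal.toReal_pow, sq, ← Measure.prod_prod]
    rfl
  have hXr : Measurable fun a => μ.real {B | R a B} := hXm.ennreal_toReal
  have hi : Integrable (fun a => μ.real {B | R a B}) μ :=
    int_of_bdd μ hXr (fun _ => measureReal_nonneg) fun _ => measureReal_le_one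
  have hi2 : Integrable (fun a => (μ.real {B | R a B}) ^ 2) μ :=
    int_of_bdd μ (hXr.pow_const 2) (fun _ => sq_nonneg _)
      fun _ => pow_le_one₀ measureReal_nonneg measureReal_le_one
  have h3 : ∫ a, (μ.real {B | R a B} - 1 / 4) ∂μ ≤ ∫ a, (μ.real {B | R a B}) ^ 2 ∂μ :=
    integral_mono (hi.sub (integrable_const _)) hi2
      fun a => by nlinarith [sq_nonneg (μ.real {B | R a B} - 1 / 2)]
  rw [integral_sub hi (integrable_const _), EX_half μ R hR hasym htot] at h3
  simp at h3
  rw [h1, h2]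
  linarith

theorem EY2_ge (hR : MeasurableSet {p : α × α | R p.1 p.2})
    (hasym : ∀ a b, R a b → ¬ R b a)
    (htot : ∀ᵐ p ∂(μ.prod μ), R p.1 p.2 ∨ R p.2 p.1) {c₁ c₂ : ℝ} (hc₁ : 0 < c₁)
    (hY : ENNReal.ofReal c₂ ≤ (μ.prod μ)
      {p | |(μ {A | R A p.1 ∧ R A p.2}).toReal - 1 / 4| ≥ c₁}) :
    ENNReal.ofReal (1 / 16 + c₂ * c₁ ^ 2) ≤
      ∫⁻ p, (μ {A | R A p.1 ∧ R A p.2}) ^ 2 ∂(μ.prod μ) := by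
  have hYm : Measurable fun p : α × α => μ.real {A | R A p.1 ∧ R A p.2} :=
    (EY_meas μ R hR).ennreal_toReal
  have hi : Integrable (fun p : α × α => μ.real {A | R A p.1 ∧ R A p.2}) (μ.prod μ) :=
    int_of_bdd _ hYm (fun _ => measureReal_nonneg) fun _ => measureReal_le_one
  have hi2 : Integrable (fun p : α × α => (μ.real {A | R A p.1 ∧ R A p.2}) ^ 2) (μ.prod μ) :=
    int_of_bdd _ (hYm.pow_const 2) (fun _ => sq_nonneg _)
      fun _ => pow_le_one₀ measureReal_nonneg measureReal_le_one
  set S : Set (α × α) := {p | |(μ {A | R A p.1 ∧ R A p.2}).toReal - 1 / 4| ≥ c₁} with hS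
  have hSm : MeasurableSet S := measurableSet_le measurable_const
    (by have := (hYm.sub_const (1/4)).abs; exact this)
  have hc : c₂ ≤ (μ.prod μ).real S := by
    exact (ENNReal.ofReal_le_iff_le_toReal (measure_ne_top _ _)).1 hY
  have e : ∫⁻ p, (μ {A | R A p.1 ∧ R A p.2}) ^ 2 ∂(μ.prod μ) =
      ENNReal.ofReal (∫ p, (μ.real {A | R A p.1 ∧ R A p.2}) ^ 2 ∂(μ.prod μ)) := by
    rw [ofReal_integral_eq_lintegral_ofReal hi2 (ae_of_all _ fun _ => sq_nonneg _)]
    refine lintegral_congr fun p => ?_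
    rw [ENNReal.ofReal_pow measureReal_nonneg, ofReal_measureReal]
  rw [e]
  refine ENNReal.ofReal_le_ofReal ?_
  have h3 : ∫ p, (S.indicator (fun _ => c₁ ^ 2) p +
        (1 / 2 * μ.real {A | R A p.1 ∧ R A p.2} - 1 / 16)) ∂(μ.prod μ) ≤
      ∫ p, (μ.real {A | R A p.1 ∧ R A p.2}) ^ 2 ∂(μ.prod μ) := by
    refine integral_mono (((integrable_const _).indicator hSm).add
      ((hi.const_mul _).sub (integrable_const _))) hi2 fun p => ?_
    by_cases hp : p ∈ S
    · have hp' : c₁ ≤ |μ.real {A | R A p.1 ∧ R A p.2} - 1 / 4| := hp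
      have := pow_le_pow_left₀ hc₁.le hp' 2
      rw [sq_abs] at this
      simp only [Set.indicator_of_mem hp]
      nlinarith
    · simp only [Set.indicator_of_notMem hp]
      nlinarith [sq_nonneg (μ.real {A | R A p.1 ∧ R A p.2} - 1 / 4)]
  have hib : Integrable (fun p : α × α =>
      1 / 2 * μ.real {A | R A p.1 ∧ R A p.2} - 1 / 16) (μ.prod μ) :=
    (hi.const_mul _).sub (integrable_const _)
  rw [integral_add ((integrable_const _).indicator hSm) hib,
    integral_sub (hi.const_mul _) (integrable_const _), integral_const_mul,
    integral_indicator_const _ hSm] at h3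
  have h4 := EY_ge μ R hR hasym htot
  simp only [integral_const, smul_eq_mul, probReal_univ] at h3
  nlinarith [mul_le_mul_of_nonneg_right hc (sq_nonneg c₁)]

theorem trans_of_quad {D : Fin 4 → α} {σ : Equiv.Perm (Fin 4)} (h : D ∈ quadEvent R σ)
    (h01 : R (D (σ 0)) (D (σ 1)) ∨ R (D (σ 1)) (D (σ 0)))
    (h23 : R (D (σ 2)) (D (σ 3)) ∨ R (D (σ 3)) (D (σ 2))) :
    ∃ σ : Equiv.Perm (Fin 4), ∀ i j : Fin 4, i < j → R (D (σ i)) (D (σ j)) := by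
  obtain ⟨⟨h1, h2⟩, h3, h4⟩ := h
  have key : ∀ τ : Equiv.Perm (Fin 4), R (D (τ 0)) (D (τ 1)) → R (D (τ 0)) (D (τ 2)) →
      R (D (τ 0)) (D (τ 3)) → R (D (τ 1)) (D (τ 2)) → R (D (τ 1)) (D (τ 3)) →
      R (D (τ 2)) (D (τ 3)) → ∀ i j : Fin 4, i < j → R (D (τ i)) (D (τ j)) := by
    intro τ a b c d e f i j hij
    fin_cases i <;> fin_cases j <;> first | assumption | (exact absurd hij (by decide))
  have s1 : (Equiv.swap (0 : Fin 4) 1) 2 = 2 := by decide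
  have s2 : (Equiv.swap (0 : Fin 4) 1) 3 = 3 := by decide
  have s3 : (Equiv.swap (2 : Fin 4) 3) 0 = 0 := by decide
  have s4 : (Equiv.swap (2 : Fin 4) 3) 1 = 1 := by decide
  rcases h01 with h01 | h01 <;> rcases h23 with h23 | h23
  · exact ⟨σ, key σ h01 h1 h2 h3 h4 h23⟩
  · refine ⟨(Equiv.swap 2 3).trans σ, key _ ?_ ?_ ?_ ?_ ?_ ?_⟩ <;>
      simpa only [Equiv.trans_apply, s3, s4, Equiv.swap_apply_left, Equiv.swap_apply_right]
  · refine ⟨(Equiv.swap 0 1).trans σ, key _ ?_ ?_ ?_ ?_ ?_ ?_⟩ <;>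
      simpa only [Equiv.trans_apply, s1, s2, Equiv.swap_apply_left, Equiv.swap_apply_right]
  · refine ⟨((Equiv.swap 0 1).trans (Equiv.swap 2 3)).trans σ, key _ ?_ ?_ ?_ ?_ ?_ ?_⟩ <;>
      simpa only [Equiv.trans_apply, s1, s2, s3, s4, Equiv.swap_apply_left,
        Equiv.swap_apply_right]

theorem ae_tot (hR : MeasurableSet {p : α × α | R p.1 p.2})
    (htot : ∀ᵐ p ∂(μ.prod μ), R p.1 p.2 ∨ R p.2 p.1) (σ : Equiv.Perm (Fin 4)) :
    ∀ᵐ D ∂(Measure.pi fun _ : Fin 4 => μ),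
      (R (D (σ 0)) (D (σ 1)) ∨ R (D (σ 1)) (D (σ 0))) ∧
      (R (D (σ 2)) (D (σ 3)) ∨ R (D (σ 3)) (D (σ 2))) := by
  have h : ∀ i j : Fin 4, MeasurableSet {D : Fin 4 → α | R (D i) (D j)} := fun i j =>
    rel_meas hR (measurable_pi_apply i) (measurable_pi_apply j)
  have hm : MeasurableSet {D : Fin 4 → α | (R (D (σ 0)) (D (σ 1)) ∨ R (D (σ 1)) (D (σ 0))) ∧
      (R (D (σ 2)) (D (σ 3)) ∨ R (D (σ 3)) (D (σ 2)))} :=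
    ((h _ _).union (h _ _)).inter ((h _ _).union (h _ _))
  rw [← (quadMap_mp μ σ).map_eq]
  refine (ae_map_iff (quadMap_measurable σ).aemeasurable hm).2 ?_
  simp only [quadMap_apply]
  filter_upwards [Measure.quasiMeasurePreserving_fst.ae htot,
    Measure.quasiMeasurePreserving_snd.ae htot] with q h1 h2
  exact ⟨h2, h1⟩

theorem exists_perm_pair : ∀ S : Finset (Fin 4), S.card = 2 →
    ∃ σ : Equiv.Perm (Fin 4), S = {σ 0, σ 1} := by decide

theorem abstract_main (hR : MeasurableSet {p : α × α | R p.1 p.2})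
    (hasym : ∀ a b, R a b → ¬ R b a)
    (htot : ∀ᵐ p ∂(μ.prod μ), R p.1 p.2 ∨ R p.2 p.1) {c₁ c₂ : ℝ} (hc₁ : 0 < c₁)
    (hY : ENNReal.ofReal c₂ ≤ (μ.prod μ)
      {p | |(μ {A | R A p.1 ∧ R A p.2}).toReal - 1 / 4| ≥ c₁}) :
    ENNReal.ofReal (3 / 8 + 6 * c₂ * c₁ ^ 2) ≤ (Measure.pi fun _ : Fin 4 => μ)
      {D | ∃ σ : Equiv.Perm (Fin 4), ∀ i j : Fin 4, i < j → R (D (σ i)) (D (σ j))} := by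
  classical
  have hex : ∀ S : Finset (Fin 4), ∃ σ : Equiv.Perm (Fin 4), S.card = 2 → S = {σ 0, σ 1} := by
    intro S
    by_cases h : S.card = 2
    · obtain ⟨σ, hσ⟩ := exists_perm_pair S h
      exact ⟨σ, fun _ => hσ⟩
    · exact ⟨1, fun h' => absurd h' h⟩
  choose σ hσ using hex
  have hdisj : Set.PairwiseDisjoint
      (↑(Finset.powersetCard 2 (Finset.univ : Finset (Fin 4))) : Set (Finset (Fin 4)))
      (fun S => quadEvent R (σ S)) := by
    have char : ∀ S : Finset (Fin 4), S.card = 2 → ∀ D ∈ quadEvent R (σ S),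
        ∀ i ∈ S, ∀ j ∉ S, R (D i) (D j) := by
      intro S hS D hD i hi j hj
      obtain ⟨⟨h1, h2⟩, h3, h4⟩ := hD
      obtain ⟨j, rfl⟩ := (σ S).surjective j
      have hS' := hσ S hS
      generalize σ S = τ at *
      subst hS'
      simp only [Finset.mem_insert, Finset.mem_singleton, EmbeddingLike.apply_eq_iff_eq,
        not_or] at hi hj
      have hj' : j = 2 ∨ j = 3 := by omega
      rcases hi with rfl | rfl <;> rcases hj' with rfl | rfl <;> assumption
    intro S hS T hT hne
    simp only [Finset.mem_coe,
      Finset.mem_powersetCard] at hS hT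
    change Disjoint (quadEvent R (σ S)) (quadEvent R (σ T))
    rw [Set.disjoint_left]
    intro D hD hD'
    have hST : ¬ S ⊆ T := fun h => hne (Finset.eq_of_subset_of_card_le h (by omega))
    have hTS : ¬ T ⊆ S := fun h => hne (Finset.eq_of_subset_of_card_le h (by omega)).symm
    obtain ⟨i, hi, hi'⟩ := Finset.not_subset.1 hST
    obtain ⟨j, hj, hj'⟩ := Finset.not_subset.1 hTS
    exact hasym _ _ (char S hS.2 D hD i hi j hj') (char T hT.2 D hD' j hj i hi')
  have hsum := measure_biUnion_finset (μ := Measure.pi fun _ : Fin 4 => μ) hdisj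
    (fun S _ => quadEvent_meas R hR (σ S))
  simp only [quadEvent_measure μ R hR, Finset.sum_const, Finset.card_powersetCard,
    Finset.card_univ, Fintype.card_fin] at hsum
  have h6 : Nat.choose 4 2 = 6 := by decide
  rw [h6] at hsum
  have hE := EY2_ge μ R hR hasym htot hc₁ hY
  calc ENNReal.ofReal (3 / 8 + 6 * c₂ * c₁ ^ 2)
      = 6 • ENNReal.ofReal (1 / 16 + c₂ * c₁ ^ 2) := by
        rw [← ENNReal.ofReal_nsmul]; congr 1; simp; ring
    _ ≤ 6 • ∫⁻ p, (μ {A | R A p.1 ∧ R A p.2}) ^ 2 ∂(μ.prod μ) := nsmul_le_nsmul_right hE 6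
    _ = _ := hsum.symm
    _ ≤ _ := by
        refine measure_mono_ae ?_
        have hall : ∀ᵐ D ∂(Measure.pi fun _ : Fin 4 => μ), ∀ τ : Equiv.Perm (Fin 4),
            (R (D (τ 0)) (D (τ 1)) ∨ R (D (τ 1)) (D (τ 0))) ∧
            (R (D (τ 2)) (D (τ 3)) ∨ R (D (τ 3)) (D (τ 2))) :=
          ae_all_iff.2 fun τ => ae_tot μ R hR htot τ
        filter_upwards [hall] with D hD hmem
        obtain ⟨S, hS⟩ := Set.mem_iUnion.1 hmem
        obtain ⟨_, hS⟩ := Set.mem_iUnion.1 hS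
        exact trans_of_quad R hS (hD _).1 (hD _).2

end abs

theorem beats_asymm {n : ℕ} (A B : Fin n → ℝ) (h : beats A B) : ¬ beats B A := by
  unfold beats at *
  have : ∑ i : Fin n, ∑ j : Fin n,
      ((if A j < B i then (1 : ℝ) else 0) - (if B i < A j then (1 : ℝ) else 0)) =
      - ∑ i : Fin n, ∑ j : Fin n,
      ((if B j < A i then (1 : ℝ) else 0) - (if A i < B j then (1 : ℝ) else 0)) := by
    rw [Finset.sum_comm]
    simp only [← Finset.sum_neg_distrib, neg_sub]
  rw [this]
  linarith

theorem beats_total {n : ℕ} (hn : Odd n) (A B : Fin n → ℝ) (h : ∀ i j, A i ≠ B j) :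
    beats A B ∨ beats B A := by
  have e : ∀ A B : Fin n → ℝ, beats A B ↔ 0 < ∑ i : Fin n, ∑ j : Fin n,
      ((if B j < A i then (1 : ℤ) else 0) - (if A i < B j then (1 : ℤ) else 0)) := by
    intro A B
    unfold beats
    rw [← Int.cast_pos (R := ℝ)]
    push_cast
    rfl
  rw [e, e]
  have neg : ∑ i : Fin n, ∑ j : Fin n,
      ((if A j < B i then (1 : ℤ) else 0) - (if B i < A j then (1 : ℤ) else 0)) =
      - ∑ i : Fin n, ∑ j : Fin n,
      ((if B j < A i then (1 : ℤ) else 0) - (if A i < B j then (1 : ℤ) else 0)) := by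
    rw [Finset.sum_comm]
    simp only [← Finset.sum_neg_distrib, neg_sub]
  rw [neg]
  have odd : Odd (∑ i : Fin n, ∑ j : Fin n,
      ((if B j < A i then (1 : ℤ) else 0) - (if A i < B j then (1 : ℤ) else 0))) := by
    have e1 : ∀ i j, ((if B j < A i then (1 : ℤ) else 0) - (if A i < B j then (1 : ℤ) else 0)) =
        1 - 2 * (if A i < B j then (1 : ℤ) else 0) := by
      intro i j
      rcases lt_or_gt_of_ne (h i j) with h1 | h1
      · rw [if_neg (not_lt.2 h1.le), if_pos h1]; norm_num
      · rw [if_pos h1, if_neg (not_lt.2 h1.le)]; norm_num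
    simp only [e1, Finset.sum_sub_distrib, ← Finset.mul_sum]
    refine Odd.sub_even ?_ (even_two_mul _)
    simp only [Finset.sum_const, Finset.card_univ, Fintype.card_fin, nsmul_eq_mul,
      mul_one]
    exact_mod_cast hn.mul hn
  obtain ⟨k, hk⟩ := odd
  omega

theorem beats_meas (n : ℕ) :
    MeasurableSet {p : (Fin n → ℝ) × (Fin n → ℝ) | beats p.1 p.2} := by
  unfold beats
  refine measurableSet_lt measurable_const ?_
  refine Finset.measurable_sum _ fun i _ => Finset.measurable_sum _ fun j _ => ?_
  have h1 : Measurable fun p : (Fin n → ℝ) × (Fin n → ℝ) => p.1 i := by fun_prop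
  have h2 : Measurable fun p : (Fin n → ℝ) × (Fin n → ℝ) => p.2 j := by fun_prop
  exact (Measurable.ite (measurableSet_lt h2 h1) measurable_const measurable_const).sub
    (Measurable.ite (measurableSet_lt h1 h2) measurable_const measurable_const)

theorem extendDie_meas (n : ℕ) (s : ℝ) : Measurable (extendDie n s) := by
  refine measurable_pi_iff.2 fun i => ?_
  unfold extendDie
  split_ifs <;> fun_prop

theorem sum_hyperplane {m : ℕ} (hm : 0 < m) (c : ℝ) :
    volume {a : Fin m → ℝ | ∑ i, a i = c} = 0 := by
  let P : AffineSubspace ℝ (Fin m → ℝ) :=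
    { carrier := {a : Fin m → ℝ | ∑ i, a i = c}
      smul_vsub_vadd_mem' := by
        intro r p q t hp hq ht
        change ∑ i, p i = c at hp
        change ∑ i, q i = c at hq
        change ∑ i, t i = c at ht
        change ∑ i, (r • (p -ᵥ q) +ᵥ t) i = c
        simp [Finset.sum_add_distrib, ← Finset.mul_sum, hp, hq, ht] }
  have hP : P ≠ ⊤ := by
    intro h
    have : (fun _ => (c + 1) / m : Fin m → ℝ) ∈ P := by rw [h]; trivial
    have h' : ∑ i : Fin m, (c + 1) / (m : ℝ) = c := this
    have hm' : (m : ℝ) ≠ 0 := by exact_mod_cast hm.ne'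
    simp at h'
    field_simp at h'
    linarith
  exact Measure.addHaar_affineSubspace volume P hP

theorem die_noatom {n : ℕ} (hn : 1 < n) (lo hi s : ℝ) (i : Fin n) (t : ℝ) :
    diceMeasure n lo hi s {A | A i = t} = 0 := by
  unfold diceMeasure
  have hmt : MeasurableSet {A : Fin n → ℝ | A i = t} :=
    measurableSet_eq_fun (measurable_pi_apply i) measurable_const
  rw [Measure.map_apply (extendDie_meas n s) hmt]
  refine cond_absolutelyContinuous ?_
  by_cases h : (i : ℕ) < n - 1
  · have := Measure.pi_hyperplane (fun _ : Fin (n - 1) => (volume : Measure ℝ)) ⟨i, h⟩ t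
    rw [← volume_pi] at this
    convert this using 2
    ext a
    simp [extendDie, h]
  · have := sum_hyperplane (m := n - 1) (by omega) (s - t)
    convert this using 2
    ext a
    have he : extendDie n s a i = s - ∑ j, a j := by simp [extendDie, h]
    change extendDie n s a i = t ↔ ∑ j, a j = s - t
    rw [he]
    change s - ∑ j, a j = t ↔ ∑ j, a j = s - t
    constructor <;> intro h <;> linarith

theorem dice_tot {n : ℕ} (hn : Odd n) (hn1 : 1 < n) (lo hi s : ℝ)
    [IsProbabilityMeasure (diceMeasure n lo hi s)] :
    ∀ᵐ p ∂((diceMeasure n lo hi s).prod (diceMeasure n lo hi s)),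
      beats p.1 p.2 ∨ beats p.2 p.1 := by
  have h : ∀ i j : Fin n, ∀ᵐ p ∂((diceMeasure n lo hi s).prod (diceMeasure n lo hi s)),
      p.1 i ≠ p.2 j := by
    intro i j
    have hm : MeasurableSet {p : (Fin n → ℝ) × (Fin n → ℝ) | p.1 i = p.2 j} :=
      measurableSet_eq_fun (by fun_prop) (by fun_prop)
    have h0 : ((diceMeasure n lo hi s).prod (diceMeasure n lo hi s))
        {p : (Fin n → ℝ) × (Fin n → ℝ) | p.1 i = p.2 j} = 0 := by
      rw [Measure.prod_apply_symm hm]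
      simp only [lintegral_eq_zero_iff (measurable_measure_prodMk_right hm)]
      exact ae_of_all _ fun b => die_noatom hn1 lo hi s i (b j)
    rw [ae_iff]
    simpa using h0
  filter_upwards [ae_all_iff.2 fun i => ae_all_iff.2 fun j => h i j] with p hp
  exact beats_total hn _ _ hp

theorem dice_zero_or_prob (n : ℕ) (s : ℝ) :
    diceMeasure n 0 1 s = 0 ∨ IsProbabilityMeasure (diceMeasure n 0 1 s) := by
  unfold diceMeasure
  rcases eq_zero_or_isProbabilityMeasure (ProbabilityTheory.cond volume
      {a : Fin (n - 1) → ℝ | (∀ i, a i ∈ Set.Icc (0:ℝ) 1) ∧ (s - ∑ i, a i) ∈ Set.Icc (0:ℝ) 1})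
    with h | h
  · left; rw [h]; simp
  · right; exact Measure.isProbabilityMeasure_map (extendDie_meas n s).aemeasurable

theorem dice_one (s : ℝ) [IsProbabilityMeasure (diceMeasure 1 0 1 s)] :
    ∃ p, diceMeasure 1 0 1 s = Measure.dirac p := by
  have hf : extendDie 1 s = fun _ => extendDie 1 s (fun _ => 0) := by
    funext a
    congr 1
    funext i
    exact absurd i.2 (by simp)
  refine ⟨extendDie 1 s (fun _ => 0), ?_⟩
  have h1 : diceMeasure 1 0 1 s Set.univ = 1 := measure_univ
  unfold diceMeasure at *
  rw [hf, Measure.map_const] at h1 ⊢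
  simp only [Measure.smul_apply, measure_univ, smul_eq_mul, mul_one] at h1
  rw [h1, one_smul]

theorem four_three_reduction (n : ℕ) (hn : Odd n)
    (ε₁ ε₂ c₁ c₂ : ℝ) (hε₁ : 0 < ε₁) (hε₂ : 0 < ε₂) (hc₁ : 0 < c₁) (hc₂ : 0 < c₂)
    (hgap : c₁ - ε₁ ^ 2 - ε₂ ≥ 0)
    (hX : (diceMeasure n 0 1 ((n : ℝ) / 2))
        {A : Fin n → ℝ |
          |((diceMeasure n 0 1 ((n : ℝ) / 2)) {B : Fin n → ℝ | beats A B}).toReal - 1 / 2| ≥ ε₁}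
      ≤ ENNReal.ofReal ε₂)
    (hY : ((diceMeasure n 0 1 ((n : ℝ) / 2)).prod (diceMeasure n 0 1 ((n : ℝ) / 2)))
        {p : (Fin n → ℝ) × (Fin n → ℝ) |
          |((diceMeasure n 0 1 ((n : ℝ) / 2))
              {A : Fin n → ℝ | beats A p.1 ∧ beats A p.2}).toReal - 1 / 4| ≥ c₁}
      ≥ ENNReal.ofReal c₂) :
    (Measure.pi fun _ : Fin 4 => diceMeasure n 0 1 ((n : ℝ) / 2))
        {D : Fin 4 → Fin n → ℝ | transitiveOnFour D}
      ≥ ENNReal.ofReal (3 / 8 + 6 * c₂ * (c₁ - ε₁ ^ 2 - ε₂) ^ 2) := by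
  rcases dice_zero_or_prob n ((n : ℝ) / 2) with h0 | hprob
  · rw [h0] at hY
    simp at hY
    linarith
  have h2 : (c₁ - ε₁ ^ 2 - ε₂) ^ 2 ≤ c₁ ^ 2 :=
    pow_le_pow_left₀ hgap (by nlinarith [sq_nonneg ε₁]) 2
  by_cases hn1 : 1 < n
  · refine le_trans (ENNReal.ofReal_le_ofReal ?_) (abstract_main _ beats (beats_meas n)
      beats_asymm (dice_tot hn hn1 0 1 _) hc₁ hY)
    nlinarith
  · exfalso
    obtain rfl : n = 1 := by have := hn.pos; omega
    obtain ⟨p, hp⟩ := dice_one (((1 : ℕ) : ℝ) / 2)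
    rw [hp] at hX hY
    have hpp : ¬ beats p p := fun h => beats_asymm p p h h
    have hX0 : Measure.dirac p {B : Fin 1 → ℝ | beats p B} = 0 := by
      rw [Measure.dirac_apply' p (rel_meas (beats_meas 1) (f := fun _ => p) (g := fun b => b)
        measurable_const measurable_id)]
      simp [hpp]
    have hY0 : Measure.dirac p {A : Fin 1 → ℝ | beats A p ∧ beats A p} = 0 := by
      simp only [and_self]
      rw [Measure.dirac_apply' p (rel_meas (beats_meas 1) (f := fun b => b) (g := fun _ => p)
        measurable_id measurable_const)]
      simp [hpp]
    have hc14 : c₁ ≤ 1 / 4 := by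
      by_contra hcon
      rw [Measure.dirac_prod_dirac] at hY
      have hYm := (EY_meas (Measure.dirac p) beats (beats_meas 1)).ennreal_toReal
      have hm : MeasurableSet {q : (Fin 1 → ℝ) × (Fin 1 → ℝ) |
          |(Measure.dirac p {A : Fin 1 → ℝ | beats A q.1 ∧ beats A q.2}).toReal - 1 / 4| ≥ c₁} :=
        measurableSet_le measurable_const (hYm.sub_const (1/4)).abs
      rw [Measure.dirac_apply' _ hm, Set.indicator_of_notMem] at hY
      · simp at hY; linarith
      · change ¬ (c₁ ≤ |(Measure.dirac p {A : Fin 1 → ℝ | beats A p ∧ beats A p}).toReal - 1 / 4|)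
        rw [hY0]
        norm_num [abs_of_pos] at hcon ⊢
        exact hcon
    have hε : ε₁ < 1 / 2 := by nlinarith
    rw [Measure.dirac_apply_of_mem] at hX
    · have : (1 : ℝ) ≤ ε₂ := by
        by_contra hcon
        push Not at hcon
        exact absurd hX (not_le.2 (by simpa using hcon))
      nlinarith [sq_nonneg ε₁]
    · change ε₁ ≤ |(Measure.dirac p {B : Fin 1 → ℝ | beats p B}).toReal - 1 / 2|
      rw [hX0]
      norm_num [abs_of_pos]
      linarith
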